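/- Let (t_k) be a sequence of positive reals with t_k → 0 and x^k → x̄ with 𝒟(x̄) nonempty and compact. Assume: (i) 𝒟 is lower semicontinuous in the Hausdorff sense at x̄; (ii) the map (t, x) ↦ 𝒟ᵗ(x) is upper semicontinuous at (0, x̄): for every ε > 0 there exist α > 0 and δ > 0 such that every point of 𝒟ᵗ(x) lies within distance ε of 𝒟(x̄) whenever t ∈ (0, α) and ‖x − x̄‖ < δ; and (iii) for each k, 𝒟(x^k) is nonempty and the set {F(x^k, y) : (y, u) ∈ 𝒟^{t_k}(x^k)} is bounded above. Then sup_{(y,u) ∈ S_p^{t_k}(x^k)} dist((y, u), S_p(x̄)) → 0 as k → ∞: for every ε > 0, for all sufficiently large k, every (y, u) ∈ S_p^{t_k}(x^k) satisfies dist((y, u), S_p(x̄)) < ε. -/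

import Mathlib

open Filter Topology Metric Set

noncomputable section

abbrev Euc (n : ℕ) : Type := EuclideanSpace ℝ (Fin n)

/-- Gradient with respect to the first variable. -/
noncomputable def gradX {n m : ℕ} (h : Euc n × Euc m → ℝ) (x : Euc n) (y : Euc m) : Euc n :=
  gradient (fun x' => h (x', y)) x

/-- Gradient with respect to the second variable. -/
noncomputable def gradY {n m : ℕ} (h : Euc n × Euc m → ℝ) (x : Euc n) (y : Euc m) : Euc m :=
  gradient (fun y' => h (x, y')) y

/-- `ℒ(x,y,u)`: gradient w.r.t. `y` of the lower-level Lagrangian. -/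
noncomputable def lagGrad {n m q : ℕ} (f : Euc n × Euc m → ℝ) (g : Fin q → Euc n × Euc m → ℝ)
    (x : Euc n) (y : Euc m) (u : Euc q) : Euc m :=
  gradY (fun p => f p + ∑ i, u i * g i p) x y

/-- The KKT set-valued map `𝒟(x)`. -/
def DSet {n m q : ℕ} (f : Euc n × Euc m → ℝ) (g : Fin q → Euc n × Euc m → ℝ) (x : Euc n) :
    Set (Euc m × Euc q) :=
  {p | lagGrad f g x p.1 p.2 = 0 ∧
    ∀ i, 0 ≤ p.2 i ∧ g i (x, p.1) ≤ 0 ∧ p.2 i * g i (x, p.1) = 0}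

/-- The Scholtes relaxation `𝒟ᵗ(x)`. -/
def DtSet {n m q : ℕ} (f : Euc n × Euc m → ℝ) (g : Fin q → Euc n × Euc m → ℝ) (t : ℝ)
    (x : Euc n) : Set (Euc m × Euc q) :=
  {p | lagGrad f g x p.1 p.2 = 0 ∧
    ∀ i, 0 ≤ p.2 i ∧ g i (x, p.1) ≤ 0 ∧ -(p.2 i * g i (x, p.1)) ≤ t}

/-- `ψ_p(x)`. -/
noncomputable def psiP {n m q : ℕ} (F f : Euc n × Euc m → ℝ) (g : Fin q → Euc n × Euc m → ℝ)
    (x : Euc n) : ℝ :=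
  sSup ((fun p : Euc m × Euc q => F (x, p.1)) '' DSet f g x)

/-- `ψ_pᵗ(x)`. -/
noncomputable def psiPt {n m q : ℕ} (F f : Euc n × Euc m → ℝ) (g : Fin q → Euc n × Euc m → ℝ)
    (t : ℝ) (x : Euc n) : ℝ :=
  sSup ((fun p : Euc m × Euc q => F (x, p.1)) '' DtSet f g t x)

/-- Maximizer set `S_p(x)`. -/
def SpSet {n m q : ℕ} (F f : Euc n × Euc m → ℝ) (g : Fin q → Euc n × Euc m → ℝ) (x : Euc n) :
    Set (Euc m × Euc q) :=
  {p | p ∈ DSet f g x ∧ ∀ p' ∈ DSet f g x, F (x, p'.1) ≤ F (x, p.1)}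

/-- Maximizer set `S_pᵗ(x)`. -/
def SpTSet {n m q : ℕ} (F f : Euc n × Euc m → ℝ) (g : Fin q → Euc n × Euc m → ℝ) (t : ℝ)
    (x : Euc n) : Set (Euc m × Euc q) :=
  {p | p ∈ DtSet f g t x ∧ ∀ p' ∈ DtSet f g t x, F (x, p'.1) ≤ F (x, p.1)}

/-- Upper-level feasible set `X`. -/
def upperX {n p : ℕ} (G : Fin p → Euc n → ℝ) : Set (Euc n) := {x | ∀ j, G j x ≤ 0}

/-- Upper-level regularity (MFCQ for the upper-level constraints). -/
def UpperLevelRegular {n p : ℕ} (G : Fin p → Euc n → ℝ) (x : Euc n) : Prop :=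
  ∀ α : Fin p → ℝ, (∀ j, 0 ≤ α j) → (∀ j, α j * G j x = 0) →
    (∑ j, α j • gradient (G j) x) = 0 → α = 0

/-- `∇_xℒ_l(x,y,u)`. -/
noncomputable def gradXL {n m q : ℕ} (f : Euc n × Euc m → ℝ) (g : Fin q → Euc n × Euc m → ℝ)
    (x : Euc n) (y : Euc m) (u : Euc q) (l : Fin m) : Euc n :=
  gradX (fun p => lagGrad f g p.1 p.2 u l) x y

/-- `∇_yℒ_l(x,y,u)`. -/
noncomputable def gradYL {n m q : ℕ} (f : Euc n × Euc m → ℝ) (g : Fin q → Euc n × Euc m → ℝ)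
    (x : Euc n) (y : Euc m) (u : Euc q) (l : Fin m) : Euc m :=
  gradY (fun p => lagGrad f g p.1 p.2 u l) x y

/-- The M-multiplier set `Λᵉᵐ(x,y,u,v)`. -/
def LambdaEM {n m q : ℕ} (f : Euc n × Euc m → ℝ) (g : Fin q → Euc n × Euc m → ℝ)
    (x : Euc n) (y : Euc m) (u : Euc q) (v : Euc n × Euc m) :
    Set ((Fin m → ℝ) × (Fin q → ℝ)) :=
  {bg | v + (∑ l, bg.1 l • (gradXL f g x y u l, gradYL f g x y u l))
        + (∑ i, bg.2 i • (gradX (g i) x y, gradY (g i) x y)) = 0 ∧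
    (∀ i, 0 < u i ∧ g i (x, y) = 0 → (∑ l, bg.1 l * gradY (g i) x y l) = 0) ∧
    (∀ i, u i = 0 ∧ g i (x, y) < 0 → bg.2 i = 0) ∧
    (∀ i, u i = 0 ∧ g i (x, y) = 0 →
      (0 < bg.2 i ∧ 0 < ∑ l, bg.1 l * gradY (g i) x y l) ∨
        bg.2 i * (∑ l, bg.1 l * gradY (g i) x y l) = 0)}

/-- The M-multiplier set `Λ_yᵉᵐ(x,y,u,w)`. -/
def LambdaYEM {n m q : ℕ} (f : Euc n × Euc m → ℝ) (g : Fin q → Euc n × Euc m → ℝ)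
    (x : Euc n) (y : Euc m) (u : Euc q) (w : Euc m) :
    Set ((Fin m → ℝ) × (Fin q → ℝ)) :=
  {bg | w + (∑ l, bg.1 l • gradYL f g x y u l) + (∑ i, bg.2 i • gradY (g i) x y) = 0 ∧
    (∀ i, 0 < u i ∧ g i (x, y) = 0 → (∑ l, bg.1 l * gradY (g i) x y l) = 0) ∧
    (∀ i, u i = 0 ∧ g i (x, y) < 0 → bg.2 i = 0) ∧
    (∀ i, u i = 0 ∧ g i (x, y) = 0 →
      (0 < bg.2 i ∧ 0 < ∑ l, bg.1 l * gradY (g i) x y l) ∨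
        bg.2 i * (∑ l, bg.1 l * gradY (g i) x y l) = 0)}

/-- Condition `(A₁ᵐ)`. -/
def A1m {n m q : ℕ} (f : Euc n × Euc m → ℝ) (g : Fin q → Euc n × Euc m → ℝ)
    (x : Euc n) (y : Euc m) (u : Euc q) : Prop :=
  ∀ bg ∈ LambdaEM f g x y u 0, bg.1 = 0 ∧ bg.2 = 0

/-- Condition `(A₂ᵐ)`. -/
def A2m {n m q : ℕ} (f : Euc n × Euc m → ℝ) (g : Fin q → Euc n × Euc m → ℝ)
    (x : Euc n) (y : Euc m) (u : Euc q) : Prop :=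
  ∀ bg ∈ LambdaYEM f g x y u 0,
    (∑ l, bg.1 l • gradXL f g x y u l) + (∑ i, bg.2 i • gradX (g i) x y) = 0

/-- The C-multiplier set `Λᵉᶜ(x,y,u,v)`. -/
def LambdaEC {n m q : ℕ} (f : Euc n × Euc m → ℝ) (g : Fin q → Euc n × Euc m → ℝ)
    (x : Euc n) (y : Euc m) (u : Euc q) (v : Euc n × Euc m) :
    Set ((Fin m → ℝ) × (Fin q → ℝ)) :=
  {bg | v + (∑ l, bg.1 l • (gradXL f g x y u l, gradYL f g x y u l))
        + (∑ i, bg.2 i • (gradX (g i) x y, gradY (g i) x y)) = 0 ∧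
    (∀ i, 0 < u i ∧ g i (x, y) = 0 → (∑ l, bg.1 l * gradY (g i) x y l) = 0) ∧
    (∀ i, u i = 0 ∧ g i (x, y) < 0 → bg.2 i = 0) ∧
    (∀ i, u i = 0 ∧ g i (x, y) = 0 →
      0 ≤ bg.2 i * (∑ l, bg.1 l * gradY (g i) x y l))}

/-- The C-multiplier set `Λ_yᵉᶜ(x,y,u,w)`. -/
def LambdaYEC {n m q : ℕ} (f : Euc n × Euc m → ℝ) (g : Fin q → Euc n × Euc m → ℝ)
    (x : Euc n) (y : Euc m) (u : Euc q) (w : Euc m) :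
    Set ((Fin m → ℝ) × (Fin q → ℝ)) :=
  {bg | w + (∑ l, bg.1 l • gradYL f g x y u l) + (∑ i, bg.2 i • gradY (g i) x y) = 0 ∧
    (∀ i, 0 < u i ∧ g i (x, y) = 0 → (∑ l, bg.1 l * gradY (g i) x y l) = 0) ∧
    (∀ i, u i = 0 ∧ g i (x, y) < 0 → bg.2 i = 0) ∧
    (∀ i, u i = 0 ∧ g i (x, y) = 0 →
      0 ≤ bg.2 i * (∑ l, bg.1 l * gradY (g i) x y l))}

/-- Condition `(A₁ᶜ)`. -/
def A1c {n m q : ℕ} (f : Euc n × Euc m → ℝ) (g : Fin q → Euc n × Euc m → ℝ)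
    (x : Euc n) (y : Euc m) (u : Euc q) : Prop :=
  ∀ bg ∈ LambdaEC f g x y u 0, bg.1 = 0 ∧ bg.2 = 0

/-- Condition `(A₂ᶜ)`. -/
def A2c {n m q : ℕ} (f : Euc n × Euc m → ℝ) (g : Fin q → Euc n × Euc m → ℝ)
    (x : Euc n) (y : Euc m) (u : Euc q) : Prop :=
  ∀ bg ∈ LambdaYEC f g x y u 0,
    (∑ l, bg.1 l • gradXL f g x y u l) + (∑ i, bg.2 i • gradX (g i) x y) = 0

/-- The C-stationarity conditions at `x` with witness `(y,u)` and multipliers `(α,β,γ)`. -/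
def CStationaryWith {n m p q : ℕ} (F f : Euc n × Euc m → ℝ) (g : Fin q → Euc n × Euc m → ℝ)
    (G : Fin p → Euc n → ℝ) (x : Euc n) (y : Euc m) (u : Euc q)
    (α : Fin p → ℝ) (β : Fin m → ℝ) (γ : Fin q → ℝ) : Prop :=
  gradX F x y + (∑ j, α j • gradient (G j) x) + (∑ l, β l • gradXL f g x y u l)
      + (∑ i, γ i • gradX (g i) x y) = 0 ∧
  gradY F x y + (∑ l, β l • gradYL f g x y u l) + (∑ i, γ i • gradY (g i) x y) = 0 ∧
  (∀ j, 0 ≤ α j ∧ G j x ≤ 0 ∧ α j * G j x = 0) ∧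
  (∀ i, 0 < u i ∧ g i (x, y) = 0 → (∑ l, β l * gradY (g i) x y l) = 0) ∧
  (∀ i, u i = 0 ∧ g i (x, y) < 0 → γ i = 0) ∧
  (∀ i, u i = 0 ∧ g i (x, y) = 0 → 0 ≤ γ i * (∑ l, β l * gradY (g i) x y l))

/-- `x` is a C-stationary point. -/
def CStationary {n m p q : ℕ} (F f : Euc n × Euc m → ℝ) (g : Fin q → Euc n × Euc m → ℝ)
    (G : Fin p → Euc n → ℝ) (x : Euc n) : Prop :=
  ∃ y u, (y, u) ∈ SpSet F f g x ∧ ∃ α β γ, CStationaryWith F f g G x y u α β γ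

/-- The stationarity system for the relaxed problem with parameter `t`. -/
def RelaxedStationary {n m p q : ℕ} (F f : Euc n × Euc m → ℝ) (g : Fin q → Euc n × Euc m → ℝ)
    (G : Fin p → Euc n → ℝ) (t : ℝ) (x : Euc n) (y : Euc m) (u : Euc q)
    (α : Fin p → ℝ) (β : Fin m → ℝ) (γ μ δ : Fin q → ℝ) : Prop :=
  (y, u) ∈ SpTSet F f g t x ∧
  gradX F x y + (∑ j, α j • gradient (G j) x) - (∑ l, β l • gradXL f g x y u l)
      - (∑ i, (γ i - δ i * u i) • gradX (g i) x y) = 0 ∧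
  gradY F x y - (∑ l, β l • gradYL f g x y u l)
      - (∑ i, (γ i - δ i * u i) • gradY (g i) x y) = 0 ∧
  (∀ i, -(∑ l, β l * gradY (g i) x y l) + μ i + δ i * g i (x, y) = 0) ∧
  (∀ j, 0 ≤ α j ∧ G j x ≤ 0 ∧ α j * G j x = 0) ∧
  (∀ i, 0 ≤ γ i ∧ g i (x, y) ≤ 0 ∧ γ i * g i (x, y) = 0) ∧
  (∀ i, 0 ≤ μ i ∧ 0 ≤ u i ∧ μ i * u i = 0) ∧
  (∀ i, 0 ≤ δ i ∧ -(u i * g i (x, y)) ≤ t ∧ δ i * (u i * g i (x, y) + t) = 0)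

/-- Lower-level optimal solution map `S(x)`. -/
def lowerS {n m q : ℕ} (f : Euc n × Euc m → ℝ) (g : Fin q → Euc n × Euc m → ℝ) (x : Euc n) :
    Set (Euc m) :=
  {y | (∀ i, g i (x, y) ≤ 0) ∧ ∀ y', (∀ i, g i (x, y') ≤ 0) → f (x, y) ≤ f (x, y')}

/-- Pessimistic value function `φ_p(x)`. -/
noncomputable def phiP {n m q : ℕ} (F f : Euc n × Euc m → ℝ)
    (g : Fin q → Euc n × Euc m → ℝ) (x : Euc n) : ℝ :=
  sSup ((fun y => F (x, y)) '' lowerS f g x)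


/-- `Ψ` is Lipschitz-like (Aubin continuous) around `(xb, zb)` with modulus `τ`. -/
def LipschitzLike {n m q : ℕ} (Ψ : Euc n → Set (Euc m × Euc q)) (xb : Euc n)
    (zb : Euc m × Euc q) (τ : ℝ) : Prop :=
  ∃ U ∈ 𝓝 xb, ∃ V ∈ 𝓝 zb, ∀ x ∈ U, ∀ x' ∈ U, ∀ z ∈ Ψ x ∩ V,
    ∃ z' ∈ Ψ x', dist z z' ≤ τ * dist x x'

/-- `Ψ` is inner semicontinuous at the point `(xb, zb)` of its graph. -/
def InnerSemicontinuousAt {α β : Type*} [TopologicalSpace α] [TopologicalSpace β]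
    (Ψ : α → Set β) (xb : α) (zb : β) : Prop :=
  ∀ xk : ℕ → α, Tendsto xk atTop (𝓝 xb) →
    ∃ zk : ℕ → β, (∀ k, zk k ∈ Ψ (xk k)) ∧ Tendsto zk atTop (𝓝 zb)

/-- If the sets `A j` are nonempty and eventually come within every `η > 0` of `z j`, then points
of `A j` can be selected whose distance to `z j` tends to `0`. -/
lemma exists_seq_mem_tendsto_dist_zero {α : Type*} [PseudoMetricSpace α] {A : ℕ → Set α}
    {z : ℕ → α} (hA : ∀ j, (A j).Nonempty)
    (h : ∀ η > 0, ∀ᶠ j in atTop, ∃ w ∈ A j, dist (z j) w ≤ η) :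
    ∃ w : ℕ → α, (∀ j, w j ∈ A j) ∧ Tendsto (fun j => dist (z j) (w j)) atTop (𝓝 0) := by
  have hsel (j : ℕ) : ∃ w ∈ A j, dist (z j) w < infDist (z j) (A j) + 1 / ((j : ℝ) + 1) :=
    (infDist_lt_iff (hA j)).1 (lt_add_of_pos_right _ Nat.one_div_pos_of_nat)
  choose w hwA hw using hsel
  have hinf : Tendsto (fun j => infDist (z j) (A j)) atTop (𝓝 0) := by
    refine Metric.tendsto_nhds.2 fun η hη => (h (η / 2) (half_pos hη)).mono ?_
    rintro j ⟨v, hv, hzv⟩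
    rw [Real.dist_0_eq_abs, abs_of_nonneg infDist_nonneg]
    linarith [infDist_le_dist_of_mem (x := z j) hv]
  refine ⟨w, hwA, squeeze_zero (fun _ => dist_nonneg) (fun j => (hw j).le) ?_⟩
  simpa using hinf.add tendsto_one_div_add_atTop_nhds_zero_nat

lemma DSet_subset_DtSet {n m q : ℕ} {f : Euc n × Euc m → ℝ} {g : Fin q → Euc n × Euc m → ℝ}
    {t : ℝ} (ht : 0 ≤ t) (x : Euc n) : DSet f g x ⊆ DtSet f g t x :=
  fun _ hp => ⟨hp.1, fun i => ⟨(hp.2 i).1, (hp.2 i).2.1, by rwa [(hp.2 i).2.2, neg_zero]⟩⟩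

/-- the excess of `S_p^{t_k}(x^k)` over `S_p(xb)` tends to `0`. -/
theorem stmt_12 {n m q : ℕ} (hn : 0 < n) (hm : 0 < m) (hq : 0 < q)
    (F f : Euc n × Euc m → ℝ) (g : Fin q → Euc n × Euc m → ℝ)
    (hf : ContDiff ℝ 1 f) (hg : ∀ i, ContDiff ℝ 1 (g i)) (hF : ContDiff ℝ 1 F)
    (t : ℕ → ℝ) (htpos : ∀ k, 0 < t k) (ht0 : Tendsto t atTop (𝓝 0))
    (xk : ℕ → Euc n) (xb : Euc n) (hconv : Tendsto xk atTop (𝓝 xb))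
    (hDne : (DSet f g xb).Nonempty) (hDcomp : IsCompact (DSet f g xb))
    (hlsc : ∀ ε > 0, ∃ δ > 0, ∀ x : Euc n, dist x xb < δ →
      ∀ z ∈ DSet f g xb, ∃ z' ∈ DSet f g x, dist z z' ≤ ε)
    (husc : ∀ ε > 0, ∃ α > 0, ∃ δ > 0, ∀ s : ℝ, 0 < s → s < α →
      ∀ x : Euc n, dist x xb < δ →
        ∀ z ∈ DtSet f g s x, ∃ z' ∈ DSet f g xb, dist z z' ≤ ε)
    (hk : ∀ k, (DSet f g (xk k)).Nonempty ∧
      BddAbove ((fun z : Euc m × Euc q => F (xk k, z.1)) '' DtSet f g (t k) (xk k))) :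
    ∀ ε > 0, ∀ᶠ k in atTop, ∀ z ∈ SpTSet F f g (t k) (xk k),
      ∃ z' ∈ SpSet F f g xb, dist z z' < ε := by
  intro ε hε
  by_contra hcon
  obtain ⟨φ, hφ, hfar⟩ := extraction_of_frequently_atTop (not_eventually.1 hcon)
  push Not at hfar
  choose z hzS hz using hfar
  have hx : Tendsto (xk ∘ φ) atTop (𝓝 xb) := hconv.comp hφ.tendsto_atTop
  have ht : Tendsto (t ∘ φ) atTop (𝓝 0) := ht0.comp hφ.tendsto_atTop
  obtain ⟨w, hwD, hzw⟩ := exists_seq_mem_tendsto_dist_zero (A := fun _ => DSet f g xb) (z := z)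
    (fun _ => hDne) fun η hη => by
      obtain ⟨α, hα, δ, hδ, H⟩ := husc η hη
      filter_upwards [ht.eventually_lt_const hα, Metric.tendsto_nhds.1 hx δ hδ] with j hjt hjx
      exact H _ (htpos _) hjt _ hjx _ (hzS j).1
  obtain ⟨p, hpD, ψ, hψ, hwp⟩ := hDcomp.tendsto_subseq hwD
  have hzp : Tendsto (z ∘ ψ) atTop (𝓝 p) :=
    (tendsto_iff_of_dist (hzw.comp hψ.tendsto_atTop)).2 hwp
  have hxψ : Tendsto (fun j => xk (φ (ψ j))) atTop (𝓝 xb) := hx.comp hψ.tendsto_atTop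
  have hFtendsto {v : ℕ → Euc m × Euc q} {b : Euc m × Euc q} (hv : Tendsto v atTop (𝓝 b)) :
      Tendsto (fun j => F (xk (φ (ψ j)), (v j).1)) atTop (𝓝 (F (xb, b.1))) :=
    (hF.continuous.tendsto _).comp (hxψ.prodMk_nhds hv.fst_nhds)
  have hpS : p ∈ SpSet F f g xb := by
    refine ⟨hpD, fun p' hp' => ?_⟩
    obtain ⟨v, hvD, hpv⟩ := exists_seq_mem_tendsto_dist_zero
      (A := fun j => DSet f g (xk (φ (ψ j)))) (z := fun _ => p') (fun j => (hk _).1)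
      fun η hη => by
        obtain ⟨δ, hδ, H⟩ := hlsc η hη
        exact (Metric.tendsto_nhds.1 hxψ δ hδ).mono fun j hj => H _ hj p' hp'
    have hv : Tendsto v atTop (𝓝 p') := (tendsto_iff_of_dist hpv).1 tendsto_const_nhds
    exact le_of_tendsto_of_tendsto' (hFtendsto hv) (hFtendsto hzp) fun j =>
      (hzS (ψ j)).2 _ (DSet_subset_DtSet (htpos _).le _ (hvD j))
  obtain ⟨j, hj⟩ := (Metric.tendsto_nhds.1 hzp ε hε).exists
  exact (hz (ψ j) p hpS).not_gt hj

end
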